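/- arXiv:1309.7884 — 3 statements merged into one kernel-verified Lean document; each statement's English description precedes it below -/
import Mathlib

section
/- Let q be an odd positive integer and let ι be an automorphism of ZMod q with ι ∘ ι = id. Let Γ be the semidirect product (ZMod q) ⋊ (ZMod 4) with respect to the homomorphism ZMod 4 → Aut(ZMod q) sending the generator 1 to ι. Then the group cohomology of Γ with trivial integer coefficients is 4-periodic in positive degrees: for every n ≥ 1 there is an isomorphism of abelian groups H^{n+4}(Γ, ℤ) ≅ H^n(Γ, ℤ). -/
open Multiplicative
open CategoryTheory groupCohomology

theorem eq_zero_of_coprime_nsmul_eq_zero {B : Type*} [AddCommGroup B] {m n : ℕ}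
    (h : Nat.Coprime m n) {b : B} (hm : m • b = 0) (hn : n • b = 0) : b = 0 :=
  AddMonoid.addOrderOf_eq_one_iff.mp (Nat.eq_one_of_dvd_coprimes h
    (addOrderOf_dvd_of_nsmul_eq_zero hm) (addOrderOf_dvd_of_nsmul_eq_zero hn))

/-- Suppose that the composites of `i` and `p` are multiplication by `4` and the norm of a
`4`-periodic operator `s` (and similarly for the primed maps), that `e` is a bijection commuting
with these operators, and that `d` is bijective up to `q`-power torsion, with `q` odd.
Then `d` and `e` can be combined into a bijection. -/
theorem bijective_of_localized_periodicity {X X' A A' : Type*} [AddCommGroup X] [AddCommGroup X']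
    [AddCommGroup A] [AddCommGroup A'] {q N : ℕ} (hq : Nat.Coprime 4 q)
    (hA : ∀ a : A, q • a = 0) (hA' : ∀ a : A', q • a = 0)
    (i : X →+ A) (p : A →+ X) (i' : X' →+ A') (p' : A' →+ X')
    (s : A →+ A) (s' : A' →+ A') (e : A →+ A') (d : X →+ X')
    (hpi : ∀ x, p (i x) = 4 • x) (hpi' : ∀ x, p' (i' x) = 4 • x)
    (hip : ∀ a, i (p a) = a + s a + s (s a) + s (s (s a)))
    (hip' : ∀ a, i' (p' a) = a + s' a + s' (s' a) + s' (s' (s' a)))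
    (hsi : ∀ x, s (i x) = i x) (hps' : ∀ a, p' (s' a) = p' a)
    (hes : ∀ a, e (s a) = s' (e a)) (he : Function.Bijective e)
    (hd : ∀ x, d x = 0 → q ^ N • x = 0) (hd' : ∀ z, ∃ x, d x = q ^ N • z) :
    Function.Bijective (q • d + p'.comp (e.comp i)) := by
  have hcop (n : ℕ) : Nat.Coprime 4 (q ^ n) := hq.pow_right n
  have hX' (x : X') : (4 * q) • x = 0 := by
    rw [mul_comm, mul_nsmul', ← hpi', ← map_nsmul, hA', map_zero]
  constructor
  · rw [injective_iff_map_eq_zero]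
    intro x hx
    simp only [AddMonoidHom.add_apply, AddMonoidHom.nsmul_apply, AddMonoidHom.comp_apply] at hx
    have hg : p' (e (i x)) = 0 := by
      refine eq_zero_of_coprime_nsmul_eq_zero hq ?_ ?_
      · have := congrArg (fun z => 4 • z) hx
        simp only [smul_add, ← mul_nsmul', hX', zero_add, smul_zero] at this
        exact this
      · rw [← map_nsmul, hA', map_zero]
    have h1 : e (i x) = 0 := by
      refine eq_zero_of_coprime_nsmul_eq_zero hq ?_ (hA' _)
      have := hip' (e (i x))
      simp only [← hes, hsi, hg, map_zero] at this
      rw [this]; abel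
    have h4 : 4 • x = 0 := by
      rw [← hpi, (injective_iff_map_eq_zero e).1 he.1 _ h1, map_zero]
    rw [hg, add_zero, ← map_nsmul] at hx
    refine eq_zero_of_coprime_nsmul_eq_zero (hcop (N + 1)) h4 ?_
    rw [pow_succ, mul_nsmul']
    exact hd _ hx
  · set f := q • d + p'.comp (e.comp i) with hf
    have hfx (x : X) : f x = q • d x + p' (e (i x)) := rfl
    have hq1 (z : X') (hz : q • z = 0) : (16 : ℕ) • z ∈ f.range := by
      obtain ⟨w, hw⟩ := he.2 (i' z)
      refine ⟨p w, ?_⟩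
      rw [hfx, ← map_nsmul, ← map_nsmul, hA, map_zero, map_zero, zero_add, hip]
      simp only [map_add, hes, hps', hw, hpi']
      abel
    have h41 (z : X') (hz : 4 • z = 0) : (q ^ (N + 2)) • z ∈ f.range := by
      obtain ⟨x, hx⟩ := hd' z
      refine ⟨q • x, ?_⟩
      rw [hfx, map_nsmul, map_nsmul i, hA, map_zero, map_zero, add_zero, hx, ← mul_nsmul',
        ← mul_nsmul']
      congr 1; ring
    intro z
    have a1 := hq1 (4 • z) (by rw [← mul_nsmul', mul_comm, hX'])
    have a2 := h41 (q • z) (by rw [← mul_nsmul', hX'])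
    rw [← mul_nsmul'] at a1 a2
    have hc : IsCoprime ((16 * 4 : ℕ) : ℤ) ((q ^ (N + 2) * q : ℕ) : ℤ) := by
      rw [Nat.isCoprime_iff_coprime, ← pow_succ]
      exact Nat.Coprime.pow_left 3 (hcop (N + 3))
    obtain ⟨u, v, huv⟩ := hc
    have : z ∈ f.range := by
      have : z = u • ((16 * 4 : ℕ) • z) + v • ((q ^ (N + 2) * q : ℕ) • z) := by
        rw [← natCast_zsmul, ← natCast_zsmul z (q ^ _ * q), ← mul_zsmul, ← mul_zsmul, ← add_zsmul,
          huv, one_zsmul]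
      rw [this]
      exact add_mem (zsmul_mem a1 u) (zsmul_mem a2 v)
    exact this

/-- A Yoneda `2`-extension of `Y` by `X`: an exact sequence `0 ⟶ X ⟶ E₀ ⟶ E₁ ⟶ Y ⟶ 0` of
representations. -/
structure TwoExtension {k : Type} [CommRing k] {G : Type} [Group G] (X Y : Rep.{0} k G) where
  E₀ : Rep.{0} k G
  E₁ : Rep.{0} k G
  f : X ⟶ E₀
  d : E₀ ⟶ E₁
  g : E₁ ⟶ Y
  injective_f : Function.Injective f.hom
  exact_d : Function.Exact f.hom d.hom
  exact_g : Function.Exact d.hom g.hom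
  surjective_g : Function.Surjective g.hom

theorem Rep.shortComplex_exact_iff {k : Type} [CommRing k] {G : Type} [Group G] (S : ShortComplex (Rep.{0} k G)) :
    S.Exact ↔ Function.Exact S.f.hom S.g.hom := by
  rw [← ShortComplex.exact_map_iff_of_faithful S (forget₂ (Rep.{0} k G) (ModuleCat.{0} k)),
    ShortComplex.moduleCat_exact_iff]
  refine ⟨fun h y => ⟨h y, ?_⟩, fun h y hy => (h y).1 hy⟩
  rintro ⟨x, rfl⟩
  exact congrArg (fun u => u.hom x) S.zero

namespace TwoExtension

variable {k : Type} [CommRing k] {G : Type} [Group G] {X Y : Rep.{0} k G} (E : TwoExtension X Y)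

theorem f_comp_d : E.f ≫ E.d = 0 := by
  exact Rep.hom_ext (Representation.IntertwiningMap.ext
    (LinearMap.ext E.exact_d.apply_apply_eq_zero))

theorem d_comp_g : E.d ≫ E.g = 0 := by
  exact Rep.hom_ext (Representation.IntertwiningMap.ext
    (LinearMap.ext E.exact_g.apply_apply_eq_zero))

/-- The left half `0 ⟶ X ⟶ E₀ ⟶ ker g ⟶ 0` of a `2`-extension. -/
noncomputable abbrev left : ShortComplex (Rep.{0} k G) :=
  ShortComplex.mk E.f (Limits.kernel.lift E.g E.d E.d_comp_g) (by
    rw [← cancel_mono (Limits.kernel.ι E.g)]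
    simp [E.f_comp_d])

/-- The right half `0 ⟶ ker g ⟶ E₁ ⟶ Y ⟶ 0` of a `2`-extension. -/
noncomputable abbrev right : ShortComplex (Rep.{0} k G) :=
  ShortComplex.mk (Limits.kernel.ι E.g) E.g (Limits.kernel.condition _)

theorem left_shortExact : E.left.ShortExact where
  exact := by
    have h : (ShortComplex.mk E.f E.d E.f_comp_d).Exact :=
      (Rep.shortComplex_exact_iff _).2 E.exact_d
    let φ : E.left ⟶ ShortComplex.mk E.f E.d E.f_comp_d :=
      { τ₁ := 𝟙 _, τ₂ := 𝟙 _, τ₃ := Limits.kernel.ι E.g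
        comm₁₂ := by simp [left]
        comm₂₃ := by simp [left] }
    have : Epi φ.τ₁ := inferInstanceAs (Epi (𝟙 X))
    have : IsIso φ.τ₂ := inferInstanceAs (IsIso (𝟙 E.E₀))
    have : Mono φ.τ₃ := inferInstanceAs (Mono (Limits.kernel.ι E.g))
    exact (ShortComplex.exact_iff_of_epi_of_isIso_of_mono φ).2 h
  mono_f := (Rep.mono_iff_injective _).2 E.injective_f
  epi_g := ShortComplex.Exact.epi_kernelLift (S := ShortComplex.mk E.d E.g E.d_comp_g)
    ((Rep.shortComplex_exact_iff _).2 E.exact_g)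

theorem right_shortExact : E.right.ShortExact where
  exact := ShortComplex.exact_kernel E.g
  mono_f := inferInstanceAs (Mono (Limits.kernel.ι E.g))
  epi_g := (Rep.epi_iff_surjective _).2 E.surjective_g

/-- The iterated connecting homomorphism of a `2`-extension. -/
noncomputable def conn (n : ℕ) : groupCohomology Y n ⟶ groupCohomology X (n + 2) :=
  δ E.right_shortExact n (n + 1) rfl ≫ δ E.left_shortExact (n + 1) (n + 2) rfl

theorem conn_apply (n : ℕ) (x : groupCohomology Y n) :
    E.conn n x = δ E.left_shortExact (n + 1) (n + 2) rfl (δ E.right_shortExact n (n + 1) rfl x) :=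
  rfl

theorem sq_nsmul_eq_zero_of_conn_eq_zero {m : ℕ}
    (h₀ : ∀ n, ∀ x : groupCohomology E.E₀ (n + 1), m • x = 0)
    (h₁ : ∀ n, ∀ x : groupCohomology E.E₁ (n + 1), m • x = 0) {n : ℕ}
    (x : groupCohomology Y (n + 1))
    (hx : E.conn (n + 1) x = 0) : m ^ 2 • x = 0 := by
  rw [conn_apply] at hx
  obtain ⟨e, he⟩ := (ShortComplex.moduleCat_exact_iff _).1
    (mapShortComplex₃_exact E.left_shortExact (i := n + 2) rfl) _ hx
  have h2 : δ E.right_shortExact (n + 1) (n + 2) rfl (m • x) = 0 := by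
    refine (map_nsmul _ m x).trans ?_
    refine (congrArg (m • ·) he.symm).trans ?_
    refine (map_nsmul _ m e).symm.trans ?_
    exact (congrArg _ (h₀ _ e)).trans (map_zero _)
  obtain ⟨e', he'⟩ := (ShortComplex.moduleCat_exact_iff _).1
    (mapShortComplex₃_exact E.right_shortExact (i := n + 1) rfl) _ h2
  rw [pow_two, mul_nsmul']
  refine (congrArg (m • ·) he'.symm).trans ?_
  refine (map_nsmul _ m e').symm.trans ?_
  exact (congrArg _ (h₁ _ e')).trans (map_zero _)

theorem exists_conn_eq_sq_nsmul {m : ℕ}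
    (h₀ : ∀ n, ∀ x : groupCohomology E.E₀ (n + 1), m • x = 0)
    (h₁ : ∀ n, ∀ x : groupCohomology E.E₁ (n + 1), m • x = 0) {n : ℕ}
    (z : groupCohomology X (n + 3)) :
    ∃ x, E.conn (n + 1) x = m ^ 2 • z := by
  obtain ⟨w, hw⟩ := (ShortComplex.moduleCat_exact_iff _).1
    (mapShortComplex₁_exact E.left_shortExact (i := n + 2) (j := n + 3) rfl) (m • z)
    ((map_nsmul _ m z).trans (h₀ _ _))
  obtain ⟨x, hx⟩ := (ShortComplex.moduleCat_exact_iff _).1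
    (mapShortComplex₁_exact E.right_shortExact (i := n + 1) (j := n + 2) rfl) (m • w)
    ((map_nsmul _ m w).trans (h₁ _ _))
  refine ⟨x, (conn_apply E (n + 1) x).trans ?_⟩
  rw [pow_two, mul_nsmul']
  refine (congrArg _ hx).trans ?_
  refine (map_nsmul _ m w).trans ?_
  exact congrArg (m • ·) hw

theorem conn_naturality {X' Y' : Rep.{0} k G} (E' : TwoExtension X' Y') (a : X ⟶ X')
    (b₀ : E.E₀ ⟶ E'.E₀) (b₁ : E.E₁ ⟶ E'.E₁) (c : Y ⟶ Y') (hf : E.f ≫ b₀ = a ≫ E'.f)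
    (hd : E.d ≫ b₁ = b₀ ≫ E'.d) (hg : E.g ≫ c = b₁ ≫ E'.g) (n : ℕ) :
    E.conn n ≫ (functor k G (n + 2)).map a = (functor k G n).map c ≫ E'.conn n := by
  let κ : Limits.kernel E.g ⟶ Limits.kernel E'.g := Limits.kernel.map _ _ b₁ c hg
  let φ : E.left ⟶ E'.left :=
    { τ₁ := a, τ₂ := b₀, τ₃ := κ
      comm₁₂ := hf.symm
      comm₂₃ := by
        rw [← cancel_mono (Limits.kernel.ι E'.g)]
        simp [left, κ, hd] }
  let ψ : E.right ⟶ E'.right :=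
    { τ₁ := κ, τ₂ := b₁, τ₃ := c
      comm₁₂ := by simp [right, κ]
      comm₂₃ := hg.symm }
  have h1 := δ_naturality E.left_shortExact E'.left_shortExact φ (n + 1) (n + 2) rfl
  have h2 := δ_naturality E.right_shortExact E'.right_shortExact ψ n (n + 1) rfl
  refine (Category.assoc _ _ _).trans ?_
  refine (congrArg (δ E.right_shortExact n (n + 1) rfl ≫ ·) h1).trans ?_
  refine (Category.assoc _ _ _).symm.trans ?_
  refine (congrArg (· ≫ δ E'.left_shortExact (n + 1) (n + 2) rfl) h2).trans ?_
  exact Category.assoc _ _ _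

end TwoExtension

instance {k : Type} [CommRing k] {G : Type} [Group G] (n : ℕ) : (functor k G n).Additive :=
  inferInstanceAs (cochainsFunctor k G ⋙ HomologicalComplex.homologyFunctor _ _ n).Additive

section Cohomology

variable {k : Type} [CommRing k] {G : Type} [Group G]

/-- The additive map induced on group cohomology by a morphism of representations. -/
noncomputable def cohMap {A B : Rep.{0} k G} (f : A ⟶ B) (n : ℕ) :
    groupCohomology A n →+ groupCohomology B n :=
  ((functor k G n).map f).hom.toAddMonoidHom

theorem cohMap_id (A : Rep.{0} k G) (n : ℕ) : cohMap (𝟙 A) n = AddMonoidHom.id _ := by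
  ext x
  exact congrArg (fun u => u.hom x) ((functor k G n).map_id A)

theorem cohMap_comp_apply {A B C : Rep.{0} k G} (f : A ⟶ B) (g : B ⟶ C) (n : ℕ)
    (x : groupCohomology A n) : cohMap (f ≫ g) n x = cohMap g n (cohMap f n x) :=
  congrArg (fun u => u.hom x) ((functor k G n).map_comp f g)

theorem cohMap_add_apply {A B : Rep.{0} k G} (f g : A ⟶ B) (n : ℕ)
    (x : groupCohomology A n) : cohMap (f + g) n x = cohMap f n x + cohMap g n x :=
  congrArg (fun u => u.hom x) ((functor k G n).map_add (f := f) (g := g))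

theorem cohMap_nsmul_apply {A B : Rep.{0} k G} (m : ℕ) (f : A ⟶ B) (n : ℕ)
    (x : groupCohomology A n) : cohMap (m • f) n x = m • cohMap f n x :=
  congrArg (fun u => u.hom x) ((functor k G n).map_nsmul (f := f) (n := m))

namespace TwoExtension

variable {X Y : Rep.{0} k G} (E : TwoExtension X Y)

/-- The iterated connecting homomorphism of a `2`-extension, as an additive map. -/
noncomputable def connHom (n : ℕ) : groupCohomology Y n →+ groupCohomology X (n + 2) :=
  (E.conn n).hom.toAddMonoidHom

theorem connHom_naturality {X' Y' : Rep.{0} k G} (E' : TwoExtension X' Y') (a : X ⟶ X')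
    (b₀ : E.E₀ ⟶ E'.E₀) (b₁ : E.E₁ ⟶ E'.E₁) (c : Y ⟶ Y') (hf : E.f ≫ b₀ = a ≫ E'.f)
    (hd : E.d ≫ b₁ = b₀ ≫ E'.d) (hg : E.g ≫ c = b₁ ≫ E'.g) (n : ℕ) (y : groupCohomology Y n) :
    cohMap a (n + 2) (E.connHom n y) = E'.connHom n (cohMap c n y) :=
  congrArg (fun u => u.hom y) (E.conn_naturality E' a b₀ b₁ c hf hd hg n)

theorem connHom_bijective (h₀ : ∀ n, ∀ x : groupCohomology E.E₀ (n + 1), x = 0)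
    (h₁ : ∀ n, ∀ x : groupCohomology E.E₁ (n + 1), x = 0) (n : ℕ) :
    Function.Bijective (E.connHom (n + 1)) := by
  have h₀' (n : ℕ) (x : groupCohomology E.E₀ (n + 1)) : 1 • x = 0 := (one_nsmul x).trans (h₀ n x)
  have h₁' (n : ℕ) (x : groupCohomology E.E₁ (n + 1)) : 1 • x = 0 := (one_nsmul x).trans (h₁ n x)
  constructor
  · rw [injective_iff_map_eq_zero]
    intro x hx
    simpa using E.sq_nsmul_eq_zero_of_conn_eq_zero h₀' h₁' x hx
  · intro z
    obtain ⟨x, hx⟩ := E.exists_conn_eq_sq_nsmul h₀' h₁' z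
    exact ⟨x, hx.trans (by simp)⟩

end TwoExtension

/-- The representation of `G` on the functions on a group `Q` given by right translation along a
homomorphism `π : G →* Q`. -/
noncomputable abbrev Rep.functions (k : Type) [CommRing k] {G Q : Type} [Group G] [Group Q]
    (π : G →* Q) : Rep.{0} k G :=
  Rep.of (X := Q → k)
    { toFun g := LinearMap.funLeft k k (· * π g)
      map_one' := by ext; simp [LinearMap.funLeft]
      map_mul' g h := by ext; simp [LinearMap.funLeft, mul_assoc] }

theorem groupCohomology_functions_id_eq_zero (n : ℕ)
    (x : groupCohomology (Rep.functions k (MonoidHom.id G)) (n + 1)) : x = 0 := by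
  let S : Subgroup G := ⊥
  let A : Rep.{0} k S := Rep.trivial k S k
  let e : Rep.functions k (MonoidHom.id G) ≅ Rep.coind S.subtype A :=
    Rep.mkIso (Representation.Equiv.mk
      { toFun f := ⟨f, fun g h => by
          have : (S.subtype g) = 1 := Subgroup.mem_bot.1 g.2
          rw [this, one_mul]; rfl⟩
        invFun f := f.1
        map_add' _ _ := rfl
        map_smul' _ _ := rfl
        left_inv _ := rfl
        right_inv _ := rfl } fun g => rfl)
  have h : Limits.IsZero (groupCohomology (Rep.functions k (MonoidHom.id G)) (n + 1)) :=
    (isZero_groupCohomology_succ_of_subsingleton A n).of_iso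
      ((functor k G (n + 1)).mapIso e ≪≫ coindIso A (n + 1))
  have := ModuleCat.subsingleton_of_isZero h
  exact Subsingleton.elim _ _

end Cohomology

section ZMod

variable {m : ℕ} [NeZero m] {k : Type*} [AddCommGroup k]

theorem ZMod.sum_range_natCast (F : ZMod m → k) : ∑ i ∈ Finset.range m, F i = ∑ c, F c := by
  refine Finset.sum_bij (fun i _ => (i : ZMod m)) (fun _ _ => Finset.mem_univ _) ?_ ?_ ?_
  · intro a ha b hb h
    have := (ZMod.natCast_eq_natCast_iff' a b m).1 h
    rwa [Nat.mod_eq_of_lt (Finset.mem_range.1 ha), Nat.mod_eq_of_lt (Finset.mem_range.1 hb)] at this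
  · exact fun c _ => ⟨c.val, Finset.mem_range.2 c.val_lt, ZMod.natCast_zmod_val c⟩
  · exact fun _ _ => rfl

theorem ZMod.exists_sub_eq_of_sum_eq_zero (F : ZMod m → k) (hF : ∑ c, F c = 0) :
    ∃ g : ZMod m → k, ∀ c, g (1 + c) - g c = F c := by
  have key (i : ℕ) (hi : i < m) : ∑ j ∈ Finset.range (1 + (i : ZMod m)).val, F j =
      ∑ j ∈ Finset.range (i + 1), F j := by
    have h : (1 + (i : ZMod m)) = ((i + 1 : ℕ) : ZMod m) := by push_cast; ring
    rw [h, ZMod.val_natCast]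
    rcases Nat.lt_or_ge (i + 1) m with h1 | h1
    · rw [Nat.mod_eq_of_lt h1]
    · have h2 : i + 1 = m := by omega
      rw [h2, Nat.mod_self, Finset.sum_range_zero, ZMod.sum_range_natCast, hF]
  refine ⟨fun c => ∑ j ∈ Finset.range c.val, F j, fun c => ?_⟩
  have := key c.val c.val_lt
  rw [ZMod.natCast_zmod_val] at this
  simp only [this, Finset.sum_range_succ, ZMod.natCast_zmod_val, add_sub_cancel_left]

theorem exists_div_eq_of_sum_eq_zero (F : Multiplicative (ZMod m) → k) (hF : ∑ c, F c = 0) :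
    ∃ g : Multiplicative (ZMod m) → k, ∀ c, g (ofAdd 1 * c) - g c = F c := by
  obtain ⟨g, hg⟩ := ZMod.exists_sub_eq_of_sum_eq_zero (fun c => F (ofAdd c))
    ((Fintype.sum_equiv ofAdd _ _ fun _ => rfl).trans hF)
  exact ⟨fun c => g c.toAdd, fun c => hg c.toAdd⟩

theorem ofAdd_natCast {m : ℕ} (n : ℕ) : ofAdd (n : ZMod m) = ofAdd (1 : ZMod m) ^ n := by
  rw [← ofAdd_nsmul, nsmul_one]

theorem eq_ofAdd_one_pow (c : Multiplicative (ZMod m)) : c = ofAdd (1 : ZMod m) ^ c.toAdd.val := by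
  rw [← ofAdd_natCast, ZMod.natCast_zmod_val]; rfl

end ZMod

section Functions

variable {k : Type} [CommRing k] {G Q : Type} [Group G] [Group Q] (π : G →* Q)

namespace Rep

theorem functions_hom_ext {A : Rep.{0} k G} {a b : A ⟶ Rep.functions k π}
    (h : ∀ f c, a.hom f c = b.hom f c) : a = b :=
  Rep.hom_ext (Representation.IntertwiningMap.ext (LinearMap.ext fun f => funext (h f)))

/-- Precomposition with left translation by `a`. -/
noncomputable def leftTranslation (a : Q) : Rep.functions k π ⟶ Rep.functions k π :=
  Rep.ofHom ⟨LinearMap.funLeft k k (a * ·), fun g => by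
    ext f c; simp [LinearMap.funLeft, mul_assoc]⟩

/-- Precomposition with `π : G →* Q`. -/
noncomputable def pullback : Rep.functions k π ⟶ Rep.functions k (MonoidHom.id G) :=
  Rep.ofHom ⟨LinearMap.funLeft k k π, fun g => by ext f c; simp [LinearMap.funLeft]⟩

/-- The inclusion of the constant functions. -/
noncomputable def const : Rep.trivial k G k ⟶ Rep.functions k π :=
  Rep.ofHom ⟨LinearMap.pi fun _ => LinearMap.id, fun g => by ext; rfl⟩

/-- Summation of a function over the finite group `Q`. -/
noncomputable def sum [Fintype Q] : Rep.functions k π ⟶ Rep.trivial k G k :=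
  Rep.ofHom ⟨∑ c, LinearMap.proj c, fun g => by
    refine LinearMap.ext fun f => ?_
    simpa using Fintype.sum_equiv (Equiv.mulRight (π g)) (fun c => f (c * π g)) f fun _ => rfl⟩

theorem sum_apply [Fintype Q] (f : Q → k) : (sum (k := k) π).hom f = ∑ c, f c := by
  change (∑ c, LinearMap.proj c : (Q → k) →ₗ[k] k) f = _
  simp

theorem const_comp_sum [Fintype Q] :
    const (k := k) π ≫ sum π = Fintype.card Q • 𝟙 (Rep.trivial k G k) := by
  refine Rep.hom_ext (Representation.IntertwiningMap.ext (LinearMap.ext fun a => ?_))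
  change (sum (k := k) π).hom (fun _ => a) = (Fintype.card Q • 𝟙 (Rep.trivial k G k)).hom a
  rw [sum_apply, Finset.sum_const, Finset.card_univ]
  rfl

theorem leftTranslation_comp_sum [Fintype Q] (a : Q) :
    leftTranslation (k := k) π a ≫ sum π = sum π := by
  refine Rep.hom_ext (Representation.IntertwiningMap.ext (LinearMap.ext fun f => ?_))
  change (sum (k := k) π).hom (fun c => f (a * c)) = (sum (k := k) π).hom f
  rw [sum_apply, sum_apply]
  exact Fintype.sum_equiv (Equiv.mulLeft a) _ _ fun _ => rfl

end Rep

end Functions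

section Cyclic

variable {k : Type} [CommRing k] {G : Type} [Group G] {m : ℕ} [NeZero m]
  (π : G →* Multiplicative (ZMod m))

theorem apply_eq_apply_one {α : Type*} {F : Multiplicative (ZMod m) → α} (h : ∀ c, F (ofAdd 1 * c) = F c)
    (c : Multiplicative (ZMod m)) : F c = F 1 := by
  have key (n : ℕ) : F (ofAdd 1 ^ n) = F 1 := by
    induction n with
    | zero => rw [pow_zero]
    | succ n ih => rw [pow_succ', h, ih]
  rw [eq_ofAdd_one_pow c, key]

/-- The periodicity `2`-extension of a cyclic quotient. -/
noncomputable def cyclicExtension : TwoExtension (Rep.trivial k G k) (Rep.trivial k G k) where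
  E₀ := Rep.functions k π
  E₁ := Rep.functions k π
  f := Rep.const π
  d := Rep.leftTranslation π (ofAdd 1) - 𝟙 _
  g := Rep.sum π
  injective_f a b h := congrFun h 1
  exact_d F := by
    constructor
    · intro h
      refine ⟨F 1, funext fun c => (apply_eq_apply_one (fun c => ?_) c).symm⟩
      exact sub_eq_zero.1 (congrFun h c)
    · rintro ⟨a, rfl⟩
      exact funext fun c => sub_self a
  exact_g F := by
    rw [Rep.sum_apply]
    constructor
    · intro h
      obtain ⟨g, hg⟩ := exists_div_eq_of_sum_eq_zero F h
      exact ⟨g, funext hg⟩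
    · rintro ⟨g, rfl⟩
      change ∑ c, (g (ofAdd 1 * c) - g c) = 0
      rw [Finset.sum_sub_distrib, sub_eq_zero]
      exact Fintype.sum_equiv (Equiv.mulLeft (ofAdd 1)) _ _ fun _ => rfl
  surjective_g a := by
    refine ⟨Pi.single 1 a, ?_⟩
    rw [Rep.sum_apply]
    simp

end Cyclic

section SemidirectProduct

variable {k : Type} [CommRing k] {m : ℕ} [NeZero m] {C : Type} [Group C]
  (φ : C →* MulAut (Multiplicative (ZMod m)))

open SemidirectProduct

/-- Summation over the fibres of the projection of a semidirect product. -/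
noncomputable def fibreSum : Rep.functions k (MonoidHom.id (Multiplicative (ZMod m) ⋊[φ] C)) ⟶
    Rep.functions k (rightHom (φ := φ)) :=
  Rep.ofHom ⟨LinearMap.pi fun c => ∑ n, LinearMap.proj (inl n * inr c), fun g => by
    refine LinearMap.ext fun f => funext fun c => ?_
    suffices ∑ n, f (inl n * inr c * g) = ∑ n, f (inl n * inr (c * g.right)) by
      simpa using this
    refine Fintype.sum_equiv (Equiv.mulRight (φ c g.left)) _ _ fun n => congrArg f ?_
    ext <;> simp⟩

theorem fibreSum_apply (f : Multiplicative (ZMod m) ⋊[φ] C → k) (c : C) :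
    (fibreSum (k := k) φ).hom f c = ∑ n, f (inl n * inr c) := by
  change (LinearMap.pi fun c => ∑ n, LinearMap.proj (inl n * inr c) :
    (Multiplicative (ZMod m) ⋊[φ] C → k) →ₗ[k] (C → k)) f c = _
  simp

theorem pullback_comp_fibreSum : Rep.pullback (k := k) (rightHom (φ := φ)) ≫ fibreSum φ =
    m • 𝟙 (Rep.functions k (rightHom (φ := φ))) := by
  refine Rep.functions_hom_ext _ fun f c => ?_
  refine (fibreSum_apply φ _ c).trans ?_
  refine (Finset.sum_congr rfl fun n _ => show _ = f c from ?_).trans ?_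
  · exact congrArg f (by simp)
  · rw [Finset.sum_const, Finset.card_univ, Fintype.card_multiplicative, ZMod.card]
    rfl

/-- The `2`-extension of a semidirect product with cyclic kernel, induced from the kernel. -/
noncomputable def kernelExtension : TwoExtension (Rep.functions k (rightHom (φ := φ)))
    (Rep.functions k (rightHom (φ := φ))) where
  E₀ := Rep.functions k (MonoidHom.id _)
  E₁ := Rep.functions k (MonoidHom.id _)
  f := Rep.pullback _
  d := Rep.leftTranslation _ (inl (ofAdd 1)) - 𝟙 _
  g := fibreSum φ
  injective_f a b h := funext fun c => congrFun h (inr c)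
  exact_d F := by
    constructor
    · intro h
      refine ⟨fun c => F (inr c), funext fun g => ?_⟩
      refine Eq.trans ?_ ((apply_eq_apply_one (F := fun n => F (inl n * inr g.right))
        (fun n => ?_) g.left).symm.trans ?_)
      · exact congrArg F (show inr g.right = inl 1 * inr g.right by simp)
      · have := sub_eq_zero.1 (congrFun h (inl n * inr g.right))
        refine Eq.trans (congrArg F ?_) this
        rw [map_mul, mul_assoc]
      · exact congrArg F (inl_left_mul_inr_right g)
    · rintro ⟨a, rfl⟩
      funext c
      refine sub_eq_zero.2 (congrArg a ?_)
      simp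
  exact_g F := by
    constructor
    · intro h
      have h' (c : C) : ∑ n, F (inl n * inr c) = 0 := (fibreSum_apply φ F c).symm.trans (congrFun h c)
      choose g hg using fun c => exists_div_eq_of_sum_eq_zero _ (h' c)
      refine ⟨fun x => g x.right x.left, funext fun x => ?_⟩
      refine Eq.trans ?_ ((hg x.right x.left).trans (congrArg F (inl_left_mul_inr_right x)))
      change g _ _ - g _ _ = _
      simp
    · rintro ⟨g, rfl⟩
      refine funext fun c => (fibreSum_apply φ _ c).trans ?_
      change ∑ n, (g (inl (ofAdd 1) * (inl n * inr c)) - g (inl n * inr c)) = 0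
      rw [Finset.sum_sub_distrib, sub_eq_zero]
      exact Fintype.sum_equiv (Equiv.mulLeft (ofAdd 1)) _ _ fun _ => by simp [mul_assoc]
  surjective_g a := by
    refine ⟨fun x => Pi.single (M := fun _ => k) 1 (a x.right) x.left, funext fun c => ?_⟩
    refine (fibreSum_apply φ _ c).trans ?_
    simp

end SemidirectProduct

namespace Rep

variable {k : Type} [CommRing k] {G Q : Type} [Group G] [Group Q] (π : G →* Q)

theorem leftTranslation_comp (a b : Q) :
    leftTranslation (k := k) π a ≫ leftTranslation π b = leftTranslation π (a * b) :=
  functions_hom_ext π fun f c => congrArg f (mul_assoc a b c).symm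

theorem leftTranslation_sub_id_comp {x y : Q} {v : ℕ} (hv : x * y = y * x ^ v) :
    (leftTranslation (k := k) π x - 𝟙 _) ≫ leftTranslation π y =
      (∑ i ∈ Finset.range v, leftTranslation π (y * x ^ i)) ≫ (leftTranslation π x - 𝟙 _) := by
  rw [Preadditive.sub_comp, Category.id_comp, leftTranslation_comp, Preadditive.comp_sub,
    Category.comp_id, Preadditive.sum_comp, ← Finset.sum_sub_distrib]
  simp only [leftTranslation_comp, mul_assoc, ← pow_succ]
  rw [Finset.sum_range_sub (fun i => leftTranslation π (y * x ^ i)), hv, pow_zero, mul_one]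

theorem pullback_comp_leftTranslation (a : G) :
    pullback (k := k) π ≫ leftTranslation (MonoidHom.id G) a =
      leftTranslation π (π a) ≫ pullback π :=
  functions_hom_ext _ fun f c => congrArg f (map_mul π a c)

theorem sum_comp_const (π : G →* Multiplicative (ZMod 4)) :
    sum (k := k) π ≫ const π = 𝟙 _ + leftTranslation π (ofAdd 1) +
      leftTranslation π (ofAdd 1) ≫ leftTranslation π (ofAdd 1) +
      leftTranslation π (ofAdd 1) ≫ leftTranslation π (ofAdd 1) ≫ leftTranslation π (ofAdd 1) := by
  refine functions_hom_ext π fun f c => ?_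
  refine (sum_apply π f).trans ?_
  change _ = f c + f (ofAdd 1 * c) + f (ofAdd 1 * (ofAdd 1 * c)) +
    f (ofAdd 1 * (ofAdd 1 * (ofAdd 1 * c)))
  rw [Fintype.sum_equiv (Equiv.mulRight c).symm f (fun x => f (x * c)) fun x => by simp]
  refine (Fintype.sum_equiv toAdd _ (fun i : ZMod 4 => f (ofAdd i * c)) fun _ => rfl).trans ?_
  refine (Fin.sum_univ_four _).trans ?_
  simp only [← mul_assoc, ← ofAdd_add]
  have h : f (ofAdd (0 : ZMod 4) * c) = f c := by rw [ofAdd_zero, one_mul]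
  exact congrArg (· + f (ofAdd 1 * c) + f (ofAdd 2 * c) + f (ofAdd 3 * c)) h

end Rep

section SemidirectProduct

variable {k : Type} [CommRing k] {m : ℕ} [NeZero m] {C : Type} [Group C]
  (φ : C →* MulAut (Multiplicative (ZMod m)))

open SemidirectProduct

theorem fibreSum_comp_leftTranslation (y : C) :
    fibreSum (k := k) φ ≫ Rep.leftTranslation rightHom y =
      Rep.leftTranslation (MonoidHom.id _) (inr y) ≫ fibreSum φ := by
  refine Rep.functions_hom_ext _ fun f c => ?_
  refine (fibreSum_apply φ f (y * c)).trans (Eq.trans ?_ (fibreSum_apply φ _ c).symm)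
  refine (Fintype.sum_equiv (φ y).toEquiv _ _ fun n => congrArg f ?_).symm
  ext <;> simp

theorem connHom_kernelExtension {y : C} {v : ℕ}
    (hv : (inl (ofAdd 1) * inr y : Multiplicative (ZMod m) ⋊[φ] C) = inr y * inl (ofAdd 1) ^ v)
    (n : ℕ) (a : groupCohomology (Rep.functions k (rightHom (φ := φ))) n) :
    (kernelExtension φ).connHom n (cohMap (Rep.leftTranslation rightHom y) n a) =
      v • cohMap (Rep.leftTranslation rightHom y) (n + 2) ((kernelExtension φ).connHom n a) := by
  rw [← cohMap_nsmul_apply]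
  refine ((kernelExtension φ).connHom_naturality (kernelExtension φ) _
    (∑ i ∈ Finset.range v, Rep.leftTranslation (MonoidHom.id _) (inr y * inl (ofAdd 1) ^ i))
    (Rep.leftTranslation (MonoidHom.id _) (inr y)) _ ?_ ?_ ?_ n a).symm
  · refine (Preadditive.comp_sum _ _ _).trans ?_
    refine (Finset.sum_congr rfl fun i _ => Rep.pullback_comp_leftTranslation _ _).trans ?_
    simp only [map_mul, map_pow, rightHom_inl, rightHom_inr, one_pow, mul_one, Finset.sum_const,
      Finset.card_range]
    exact (Preadditive.nsmul_comp _ _ _ ).symm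
  · exact Rep.leftTranslation_sub_id_comp _ hv
  · exact fibreSum_comp_leftTranslation φ y

theorem nsmul_groupCohomology_functions_rightHom (n : ℕ)
    (a : groupCohomology (Rep.functions k (rightHom (φ := φ))) (n + 1)) : m • a = 0 := by
  have h : cohMap (m • 𝟙 (Rep.functions k (rightHom (φ := φ)))) (n + 1) a = 0 := by
    rw [← pullback_comp_fibreSum, cohMap_comp_apply]
    exact (congrArg _ (groupCohomology_functions_id_eq_zero n _)).trans (map_zero _)
  rwa [cohMap_nsmul_apply, cohMap_id] at h

theorem connHom_connHom_kernelExtension {y : C} {v : ℕ}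
    (hv : (inl (ofAdd 1) * inr y : Multiplicative (ZMod m) ⋊[φ] C) = inr y * inl (ofAdd 1) ^ v)
    (hvv : v * v ≡ 1 [MOD m])
    (n : ℕ) (a : groupCohomology (Rep.functions k (rightHom (φ := φ))) n) :
    (kernelExtension φ).connHom (n + 2) ((kernelExtension φ).connHom n
      (cohMap (Rep.leftTranslation rightHom y) n a)) =
    cohMap (Rep.leftTranslation rightHom y) (n + 2 + 2)
      ((kernelExtension φ).connHom (n + 2) ((kernelExtension φ).connHom n a)) := by
  rw [connHom_kernelExtension φ hv, map_nsmul, connHom_kernelExtension φ hv, ← mul_nsmul']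
  set b := cohMap (Rep.leftTranslation rightHom y) (n + 2 + 2)
      ((kernelExtension φ).connHom (n + 2) ((kernelExtension φ).connHom n a))
  have hb : addOrderOf b ∣ m :=
    addOrderOf_dvd_of_nsmul_eq_zero (nsmul_groupCohomology_functions_rightHom φ (n + 3) b)
  exact (nsmul_eq_nsmul_iff_modEq.2 (hvv.of_dvd hb)).trans (one_nsmul b)

end SemidirectProduct

section FourPeriodicity

variable {k : Type} [CommRing k] {q : ℕ} [NeZero q]
  (φ : Multiplicative (ZMod 4) →* MulAut (Multiplicative (ZMod q)))

open SemidirectProduct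

theorem bijective_connHom_kernelExtension (n : ℕ) :
    Function.Bijective ((kernelExtension (k := k) φ).connHom (n + 1)) :=
  (kernelExtension φ).connHom_bijective (fun n x => groupCohomology_functions_id_eq_zero n x)
    (fun n x => groupCohomology_functions_id_eq_zero n x) n

theorem bijective_connHom_connHom_kernelExtension (n : ℕ) :
    Function.Bijective (((kernelExtension (k := k) φ).connHom (n + 3)).comp
      ((kernelExtension φ).connHom (n + 1))) :=
  by
  rw [AddMonoidHom.coe_comp]
  have h := bijective_connHom_kernelExtension (k := k) φ (n + 2)
  exact Function.Bijective.comp h (bijective_connHom_kernelExtension φ n)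

theorem nonempty_addEquiv_groupCohomology_trivial (hodd : Odd q) {v : ℕ}
    (hv : (inl (ofAdd 1) * inr (ofAdd 1) :
      Multiplicative (ZMod q) ⋊[φ] Multiplicative (ZMod 4)) = inr (ofAdd 1) * inl (ofAdd 1) ^ v)
    (hvv : v * v ≡ 1 [MOD q]) (n : ℕ) :
    Nonempty (groupCohomology
      (Rep.trivial k (Multiplicative (ZMod q) ⋊[φ] Multiplicative (ZMod 4)) k) (n + 1) ≃+
      groupCohomology
      (Rep.trivial k (Multiplicative (ZMod q) ⋊[φ] Multiplicative (ZMod 4)) k) (n + 5)) := by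
  let π : Multiplicative (ZMod q) ⋊[φ] Multiplicative (ZMod 4) →* _ := rightHom
  let E := cyclicExtension (k := k) π
  have hE (n : ℕ) (a : groupCohomology (Rep.functions k π) (n + 1)) : q • a = 0 :=
    nsmul_groupCohomology_functions_rightHom φ n a
  have hcard : Fintype.card (Multiplicative (ZMod 4)) = 4 := rfl
  have hpi (j : ℕ) (x : groupCohomology (Rep.trivial k _ k) j) :
      cohMap (Rep.sum π) j (cohMap (Rep.const π) j x) = 4 • x := by
    rw [← cohMap_comp_apply, Rep.const_comp_sum, cohMap_nsmul_apply, cohMap_id, hcard]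
    rfl
  let ρ (j : ℕ) := cohMap (Rep.leftTranslation (k := k) π (ofAdd 1)) j
  have hip (j : ℕ) (a : groupCohomology (Rep.functions k π) j) :
      cohMap (Rep.const π) j (cohMap (Rep.sum π) j a) =
        a + ρ j a + ρ j (ρ j a) + ρ j (ρ j (ρ j a)) := by
    rw [← cohMap_comp_apply, Rep.sum_comp_const]
    simp only [cohMap_add_apply, cohMap_comp_apply, cohMap_id]
    rfl
  refine ⟨AddEquiv.ofBijective _ (bijective_of_localized_periodicity (q := q) (N := 4)
    (Nat.Coprime.pow_left 2 hodd.coprime_two_left) (hE n) (hE (n + 4)) (cohMap (Rep.const π) _)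
    (cohMap (Rep.sum π) _) (cohMap (Rep.const π) _) (cohMap (Rep.sum π) _) (ρ _) (ρ _)
    (((kernelExtension φ).connHom (n + 3)).comp ((kernelExtension φ).connHom (n + 1)))
    ((E.connHom (n + 3)).comp (E.connHom (n + 1))) (hpi _) (hpi _) (hip _) (hip _)
    ?_ ?_ (connHom_connHom_kernelExtension φ hv hvv (n + 1))
    (bijective_connHom_connHom_kernelExtension φ n) ?_ ?_)⟩
  · intro x
    exact (cohMap_comp_apply _ _ _ _).symm
  · intro a
    refine (cohMap_comp_apply _ _ _ _).symm.trans ?_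
    rw [Rep.leftTranslation_comp_sum]
  · intro x hx
    have h1 : q ^ 2 • E.connHom (n + 1) x = 0 :=
      E.sq_nsmul_eq_zero_of_conn_eq_zero hE hE (n := n + 2) _ hx
    rw [← map_nsmul] at h1
    have h2 : q ^ 2 • q ^ 2 • x = 0 := E.sq_nsmul_eq_zero_of_conn_eq_zero hE hE _ h1
    rwa [← mul_nsmul', ← pow_add] at h2
  · intro z
    obtain ⟨w, hw⟩ := E.exists_conn_eq_sq_nsmul hE hE (n := n + 2) z
    obtain ⟨x, hx⟩ := E.exists_conn_eq_sq_nsmul hE hE (n := n) w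
    refine ⟨x, (congrArg (E.connHom (n + 3)) hx).trans ((map_nsmul _ _ _).trans ?_)⟩
    refine (congrArg (q ^ 2 • ·) hw).trans ?_
    exact (mul_nsmul' _ _ _).symm.trans (by rw [← pow_add])

end FourPeriodicity

/-- Let `q` be an odd positive integer and `ι` an automorphism of `ZMod q` with
`ι ∘ ι = id`. Let `Γ` be the semidirect product `(ZMod q) ⋊ (ZMod 4)` with respect to the
homomorphism `ZMod 4 → Aut(ZMod q)` sending the generator `1` to `ι`. Then the group cohomology
of `Γ` with trivial integer coefficients is 4-periodic in positive degrees: for every `n ≥ 1`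
there is an isomorphism of abelian groups `H^{n+4}(Γ, ℤ) ≅ H^n(Γ, ℤ)`. -/
theorem semidirect_product_four_periodic_integral_cohomology
    (q : ℕ) (hq : 0 < q) (hodd : Odd q)
    (ι : ZMod q ≃+ ZMod q) (hι : ∀ x : ZMod q, ι (ι x) = x)
    (φ : Multiplicative (ZMod 4) →* MulAut (Multiplicative (ZMod q)))
    (hφ : ∀ x : ZMod q, φ (ofAdd 1) (ofAdd x) = ofAdd (ι x)) :
    ∀ n : ℕ, 1 ≤ n →
      Nonempty
        ((groupCohomology
            (Rep.trivial ℤ (Multiplicative (ZMod q) ⋊[φ] Multiplicative (ZMod 4)) ℤ) (n + 4)) ≃+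
         (groupCohomology
            (Rep.trivial ℤ (Multiplicative (ZMod q) ⋊[φ] Multiplicative (ZMod 4)) ℤ) n)) := by
  intro n hn
  obtain ⟨n, rfl⟩ := Nat.exists_eq_add_of_le' hn
  have : NeZero q := ⟨hq.ne'⟩
  have hv : ((ι 1).val : ZMod q) = ι 1 := ZMod.natCast_zmod_val _
  obtain ⟨e⟩ := nonempty_addEquiv_groupCohomology_trivial (k := ℤ) φ hodd (v := (ι 1).val)
    (by
      rw [← map_pow, ← ofAdd_natCast, hv]
      ext <;> simp [hφ, hι])
    (by
      rw [← ZMod.natCast_eq_natCast_iff, Nat.cast_mul, Nat.cast_one]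
      nth_rw 2 [hv]
      rw [← nsmul_eq_mul, ← map_nsmul, nsmul_one, hv, hι])
    n
  exact ⟨e.symm⟩
end

section
/- Let q be an odd positive integer and let ι be an automorphism of ZMod q with ι ∘ ι = id. Let Γ be the semidirect product (ZMod q) ⋊ (ZMod 4) with respect to the homomorphism ZMod 4 → Aut(ZMod q) sending the generator 1 to ι. Then Γ has nontrivial 4-periodic mod 2 cohomology: for every natural number k, the group cohomology H^{4k+1}(Γ, F₂) with trivial coefficients in the field F₂ = ZMod 2 is nonzero. -/
open Multiplicative

open CategoryTheory

universe u

section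

variable (k : Type u) [CommRing k]

/-- The restriction of a trivial representation along a group homomorphism is trivial. -/
noncomputable def Rep.resTrivialHom {G H : Type u} [Group G] [Group H] (V : Type u)
    [AddCommGroup V] [Module k V] (f : G →* H) :
    Rep.res f (Rep.trivial k H V) ⟶ Rep.trivial k G V :=
  Rep.ofHom ⟨LinearMap.id, fun _ => rfl⟩

/-- The cohomology of a retract `H` of a group `G`, with coefficients in a trivial representation,
embeds into that of `G`. -/
theorem groupCohomology.map_resTrivialHom_injective {G H : Type u} [Group G] [Group H]
    (V : Type u) [AddCommGroup V] [Module k V] (s : H →* G) (r : G →* H)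
    (h : r.comp s = MonoidHom.id H) (n : ℕ) :
    Function.Injective (groupCohomology.map r (Rep.resTrivialHom k V r) n) := by
  have key : groupCohomology.map r (Rep.resTrivialHom k V r) n ≫
      groupCohomology.map s (Rep.resTrivialHom k V s) n = 𝟙 _ := by
    rw [← groupCohomology.map_comp, ← groupCohomology.map_id]
    exact groupCohomology.map_congr h rfl n
  have := mono_of_mono_fac key
  exact (ModuleCat.mono_iff_injective _).1 this

/-- The odd-degree cohomology of a finite cyclic group whose order vanishes in `k`, with trivial
coefficients in `k`, is nonzero. -/
theorem groupCohomology.nontrivial_trivial_of_isCyclic_of_odd [Nontrivial k] (G : Type u)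
    [CommGroup G] [Fintype G] [IsCyclic G] (hG : (Fintype.card G : k) = 0) (n : ℕ) (hn : Odd n) :
    Nontrivial (groupCohomology (Rep.trivial k G k) n) := by
  obtain ⟨g, hg⟩ := IsCyclic.exists_generator (α := G)
  have hker : (1 : k) ∈ LinearMap.ker (Rep.trivial k G k).norm.hom.toLinearMap := by
    simp [Rep.norm, Representation.norm, hG]
  refine nontrivial_of_ne
    (Rep.FiniteCyclicGroup.groupCohomologyπOdd (Rep.trivial k G k) g hg n hn ⟨1, hker⟩) 0
    fun h => ?_
  obtain ⟨x, hx⟩ :=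
    (Rep.FiniteCyclicGroup.groupCohomologyπOdd_eq_zero_iff _ g hg n hn ⟨1, hker⟩).1 h
  simp [Rep.sub_hom, Rep.applyAsHom] at hx

end

/-- Let `q` be an odd positive integer and `ι` an automorphism of `ZMod q` with
`ι ∘ ι = id`. Let `Γ` be the semidirect product `(ZMod q) ⋊ (ZMod 4)` with respect to the
homomorphism `ZMod 4 → Aut(ZMod q)` sending the generator `1` to `ι`. Then `Γ` has nontrivial
4-periodic mod 2 cohomology: for every natural number `k`, the group cohomology
`H^{4k+1}(Γ, F₂)` with trivial coefficients in `F₂ = ZMod 2` is nonzero. -/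
theorem semidirect_product_nontrivial_mod_two_cohomology
    (q : ℕ) (hq : 0 < q) (hodd : Odd q)
    (ι : ZMod q ≃+ ZMod q) (hι : ∀ x : ZMod q, ι (ι x) = x)
    (φ : Multiplicative (ZMod 4) →* MulAut (Multiplicative (ZMod q)))
    (hφ : ∀ x : ZMod q, φ (ofAdd 1) (ofAdd x) = ofAdd (ι x)) :
    ∀ k : ℕ,
      Nontrivial
        (groupCohomology
          (Rep.trivial (ZMod 2) (Multiplicative (ZMod q) ⋊[φ] Multiplicative (ZMod 4)) (ZMod 2))
          (4 * k + 1)) := by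
  intro k
  have := groupCohomology.nontrivial_trivial_of_isCyclic_of_odd (ZMod 2)
    (Multiplicative (ZMod 4)) (by decide) (4 * k + 1) ⟨2 * k, by ring⟩
  exact (groupCohomology.map_resTrivialHom_injective (ZMod 2) (ZMod 2)
    SemidirectProduct.inr SemidirectProduct.rightHom
    SemidirectProduct.rightHom_comp_inr (4 * k + 1)).nontrivial
end

section
/- Let p and q be distinct odd primes, let k ≥ 1, and let β : ZMod (p^k) → Aut(ZMod q) be a group homomorphism whose image has order exactly p. Let Γ be the semidirect product (ZMod q) ⋊ (ZMod (p^k)) with respect to β. Then for every positive integer j, the group cohomology H^{2j}(Γ, F_q) with trivial coefficients in the field F_q = ZMod q vanishes if p does not divide j, and is nonzero (isomorphic to F_q) if p divides j. In particular, the minimal period of the F_q-cohomology of Γ is divisible by 2p. -/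
open Multiplicative

section Auxiliary

open CategoryTheory Limits Polynomial

universe u

section

variable {k G : Type u} [CommRing k] [Group G]

/-- The map from the representation coinduced from the trivial subgroup onto `A` sending `F` to
`∑ h, h⁻¹ • F h`. -/
noncomputable def Rep.sumCoindBot [Fintype G] (A : Rep.{u} k G) :
    Rep.coind (⊥ : Subgroup G).subtype (Rep.res (⊥ : Subgroup G).subtype A) ⟶ A :=
  Rep.ofHom
    { toLinearMap := (∑ h : G, A.ρ h⁻¹ ∘ₗ LinearMap.proj h) ∘ₗ Submodule.subtype _
      isIntertwining' := fun g => by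
        ext F
        simp only [LinearMap.comp_apply, LinearMap.sum_apply, LinearMap.proj_apply,
          Submodule.subtype_apply, map_sum, Representation.coind_apply]
        refine Fintype.sum_equiv (Equiv.mulRight g) _ _ fun h => ?_
        rw [← Module.End.mul_apply, ← map_mul]
        simp
        rfl }

/-- Higman's criterion: if the identity of `A` is the sum of the conjugates of a linear
endomorphism, then `A` has no cohomology in positive degrees. -/
theorem groupCohomology.isZero_of_sum_conj_eq_id [Fintype G] (A : Rep.{u} k G) (φ : A.V →ₗ[k] A.V)
    (h : ∀ v, ∑ g : G, A.ρ g⁻¹ (φ (A.ρ g v)) = v) (n : ℕ) :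
    IsZero (groupCohomology A (n + 1)) := by
  let S : Subgroup G := ⊥
  let f : Rep.res S.subtype A ⟶ Rep.res S.subtype A := Rep.ofHom
    { toLinearMap := φ
      isIntertwining' := fun g => by
        obtain rfl := Subsingleton.elim g 1
        ext; simp }
  have hid : Rep.resCoindToHom S.subtype A _ f ≫ Rep.sumCoindBot A = 𝟙 A := by
    ext v
    simpa [Rep.sumCoindBot, f] using h v
  have hz : IsZero ((groupCohomology.functor k G (n + 1)).obj
      (Rep.coind S.subtype (Rep.res S.subtype A))) :=
    (isZero_groupCohomology_succ_of_subsingleton _ n).of_iso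
      (groupCohomology.coindIso _ _)
  refine (IsZero.iff_id_eq_zero _).2 ?_
  have := congrArg (groupCohomology.functor k G (n + 1)).map hid
  rw [CategoryTheory.Functor.map_comp, CategoryTheory.Functor.map_id, hz.eq_zero_of_tgt
    ((groupCohomology.functor k G (n + 1)).map (Rep.resCoindToHom S.subtype A _ f)), Limits.zero_comp]
    at this
  exact this.symm

/-- If the connecting map `Hⁿ(G, X₃) ⟶ Hⁿ⁺¹(G, X₁)` has zero maps on both sides in the long exact
sequence, it is an isomorphism. -/
theorem groupCohomology.nonempty_iso_succ_of_isZero {X : ShortComplex (Rep.{u} k G)}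
    (hX : X.ShortExact) (n : ℕ)
    (hz : IsZero (groupCohomology X.X₂ (n + 1)))
    (hg : groupCohomology.map (MonoidHom.id G) X.g n = 0) :
    Nonempty (groupCohomology X.X₃ n ≅ groupCohomology X.X₁ (n + 1)) := by
  have := groupCohomology.epi_δ_of_isZero hX n hz
  have : Mono (groupCohomology.δ hX n (n + 1) rfl) :=
    (groupCohomology.mapShortComplex₃_exact hX rfl).mono_g hg
  have := isIso_of_mono_of_epi (groupCohomology.δ hX n (n + 1) rfl)
  exact ⟨asIso (groupCohomology.δ hX n (n + 1) rfl)⟩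

theorem groupCohomology.map_zero_eq_zero {A B : Rep.{u} k G} (f : A ⟶ B)
    (h : ∀ v ∈ A.ρ.invariants, f.hom v = 0) :
    groupCohomology.map (MonoidHom.id G) f 0 = 0 := by
  rw [← cancel_mono (groupCohomology.H0Iso B).hom, groupCohomology.map_id_comp_H0Iso_hom,
    Limits.zero_comp]
  have : (Rep.invariantsFunctor k G).map f = 0 := by
    ext v
    exact Subtype.ext (h v.1 v.2)
  rw [this, Limits.comp_zero]

theorem Rep.exists_shortExact_mk {A B C : Rep.{u} k G} (f : A ⟶ B) (g : B ⟶ C)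
    (hf : Function.Injective f.hom) (hg : Function.Surjective g.hom)
    (hfg : ∀ b, g.hom b = 0 ↔ ∃ a, f.hom a = b) :
    ∃ w : f ≫ g = 0, (ShortComplex.mk f g w).ShortExact := by
  have w : f ≫ g = 0 := by
    ext a
    exact (hfg _).2 ⟨a, rfl⟩
  refine ⟨w, ?_⟩
  have := (Rep.mono_iff_injective f).2 hf
  have := (Rep.epi_iff_surjective g).2 hg
  have hex : (ShortComplex.mk f g w).Exact := by
    apply Functor.reflects_exact_of_faithful (forget₂ (Rep k G) (ModuleCat k))
    rw [ShortComplex.moduleCat_exact_iff]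
    intro b hb
    exact (hfg b).1 hb
  exact { exact := hex }
end

/-- An action of `Γ` on the affine line over `F`, given by the maps
`x ↦ scale g * x + shift g` describing the action of `g⁻¹`. -/
structure AffineData (Γ F : Type) [Group Γ] [Field F] where
  scale : Γ →* F
  shift : Γ → F
  shift_mul : ∀ g h, shift (g * h) = shift h + scale h * shift g

/-- The one-dimensional representation attached to a character. -/
noncomputable def charRep {Γ F : Type} [Group Γ] [Field F] (χ : Γ →* F) : Representation F Γ F where
  toFun g := χ g • LinearMap.id
  map_one' := by ext; simp
  map_mul' g h := by ext; simp [mul_comm]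

namespace AffineData
variable {Γ F : Type} [Group Γ] [Field F] (A : AffineData Γ F)

/-- The linear polynomial describing the action of `g⁻¹` on the affine line. -/
noncomputable def poly (g : Γ) : F[X] := C (A.scale g) * X + C (A.shift g)

theorem shift_one : A.shift 1 = 0 := by
  simpa using A.shift_mul 1 1

theorem scale_inv_mul_shift (g : Γ) : A.scale g⁻¹ * A.shift g = - A.shift g⁻¹ := by
  have := A.shift_mul g g⁻¹
  rw [mul_inv_cancel, shift_one] at this
  linear_combination -this

theorem natDegree_poly_le (g : Γ) : (A.poly g).natDegree ≤ 1 := natDegree_linear_le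

theorem poly_one : A.poly 1 = X := by simp [poly, shift_one]

theorem poly_comp (g h : Γ) : (A.poly h).comp (A.poly g) = A.poly (g * h) := by
  simp only [poly, A.shift_mul, map_mul, map_add, add_comp, mul_comp, C_comp, X_comp]
  ring

theorem comp_mem_degreeLT {m : ℕ} (g : Γ) (p : F[X]) (hp : p ∈ degreeLT F m) :
    p.comp (A.poly g) ∈ degreeLT F m := by
  rw [mem_degreeLT] at hp ⊢
  by_cases h0 : p = 0
  · simpa [h0] using hp
  have h1 : (p.comp (A.poly g)).natDegree ≤ p.natDegree :=
    natDegree_comp_le.trans (mul_le_of_le_one_right' (A.natDegree_poly_le g))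
  calc (p.comp (A.poly g)).degree ≤ p.natDegree := degree_le_of_natDegree_le h1
    _ = p.degree := (degree_eq_natDegree h0).symm
    _ < m := hp

/-- The action of `Γ` on polynomials of degree less than `m`, twisted by the character `χ`. -/
noncomputable def polyRep (χ : Γ →* F) (m : ℕ) : Representation F Γ (degreeLT F m) where
  toFun g := (χ g • (aeval (A.poly g)).toLinearMap).restrict
    fun p hp => Submodule.smul_mem _ _ (A.comp_mem_degreeLT g p hp)
  map_one' := by
    ext p : 2
    simp [LinearMap.restrict_apply, poly_one]
  map_mul' g h := by
    ext p : 2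
    simp [LinearMap.restrict_apply, ← comp_eq_aeval, comp_assoc, poly_comp, smul_smul, mul_comm]

theorem polyRep_apply_coe (χ : Γ →* F) {m : ℕ} (g : Γ) (p : degreeLT F m) :
    (A.polyRep χ m g p : F[X]) = χ g • (p : F[X]).comp (A.poly g) := rfl

theorem eval_comp_poly (g : Γ) (p : F[X]) (x : F) :
    (p.comp (A.poly g)).eval x = p.eval (A.scale g * x + A.shift g) := by
  simp [poly]

theorem coeff_comp_poly {n : ℕ} (g : Γ) {p : F[X]} (hp : p ∈ degreeLT F (n + 1)) :
    (p.comp (A.poly g)).coeff n = A.scale g ^ n * p.coeff n := by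
  have hlt : p.natDegree < n + 1 := by
    by_cases h0 : p = 0
    · simp [h0]
    · exact (natDegree_lt_iff_degree_lt h0).2 (mem_degreeLT.1 hp)
  conv_lhs => rw [p.as_sum_range' (n + 1) hlt]
  simp only [Polynomial.sum_comp, finsetSum_coeff, monomial_comp, coeff_C_mul]
  rw [Finset.sum_eq_single n]
  · have := coeff_pow_of_natDegree_le (m := n) (A.natDegree_poly_le g)
    rw [mul_one] at this
    rw [this]
    simp [poly, mul_comm (p.coeff n), -X_mul_C]
  · intro i hi hin
    rw [coeff_eq_zero_of_natDegree_lt (p := A.poly g ^ i), mul_zero]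
    have h1 : i < n + 1 := Finset.mem_range.1 hi
    exact (natDegree_pow_le_of_le i (A.natDegree_poly_le g)).trans_lt (by lia)
  · simp

theorem derivative_comp_poly (g : Γ) (p : F[X]) :
    derivative (p.comp (A.poly g)) = A.scale g • (derivative p).comp (A.poly g) := by
  rw [derivative_comp, smul_eq_C_mul]
  simp [poly]

/-- The inclusion of the constant polynomials. -/
noncomputable def constMap (χ : Γ →* F) {m : ℕ} (hm : 0 < m) :
    (charRep χ).IntertwiningMap (A.polyRep χ m) where
  toLinearMap := (Algebra.linearMap F F[X]).codRestrict _ fun a =>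
    mem_degreeLT.2 (degree_C_le.trans_lt (by exact_mod_cast hm))
  isIntertwining' g := by
    ext : 2
    simp [polyRep_apply_coe, charRep, smul_eq_C_mul]

theorem derivative_mem_degreeLT {m : ℕ} {p : F[X]} (hp : p ∈ degreeLT F (m + 1)) :
    derivative p ∈ degreeLT F m := by
  rw [mem_degreeLT, degree_lt_iff_coeff_zero] at hp ⊢
  intro i hi
  rw [coeff_derivative, hp (i + 1) (by lia), zero_mul]

/-- The derivative, as an intertwining map. -/
noncomputable def derivMap (χ : Γ →* F) (m : ℕ) :
    (A.polyRep χ (m + 1)).IntertwiningMap (A.polyRep (χ * A.scale) m) where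
  toLinearMap := derivative.restrict fun _ => derivative_mem_degreeLT
  isIntertwining' g := by
    ext p : 2
    simp [LinearMap.restrict_apply, polyRep_apply_coe, derivative_comp_poly, mul_smul]

/-- The inclusion of the polynomials of degree less than `m` into those of degree at most `m`. -/
noncomputable def inclMap (χ : Γ →* F) (m : ℕ) :
    (A.polyRep χ m).IntertwiningMap (A.polyRep χ (m + 1)) where
  toLinearMap := (Submodule.subtype _).codRestrict _ fun p =>
    degreeLT_mono (Nat.le_add_right m 1) p.2
  isIntertwining' g := by
    ext p : 2
    rw [LinearMap.comp_apply, LinearMap.comp_apply, LinearMap.codRestrict_apply,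
      Submodule.subtype_apply, polyRep_apply_coe, polyRep_apply_coe, LinearMap.codRestrict_apply,
      Submodule.subtype_apply]

theorem coe_inclMap_apply (χ : Γ →* F) {m : ℕ} (r : degreeLT F m) :
    (A.inclMap χ m r : F[X]) = r :=
  LinearMap.codRestrict_apply _ _ _

/-- The coefficient of `X ^ m`, as an intertwining map. -/
noncomputable def coeffMap (χ : Γ →* F) (m : ℕ) (hm : ∀ g, A.scale g ^ m = 1) :
    (A.polyRep χ (m + 1)).IntertwiningMap (charRep χ) where
  toLinearMap := lcoeff F m ∘ₗ Submodule.subtype _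
  isIntertwining' g := by
    ext p
    simp [polyRep_apply_coe, coeff_comp_poly A g p.2, hm, charRep]

theorem coeffMap_eq_zero_iff (χ : Γ →* F) {m : ℕ} (hm) (p : degreeLT F (m + 1)) :
    A.coeffMap χ m hm p = 0 ↔ ∃ r, A.inclMap χ m r = p := by
  constructor
  · intro h
    replace h : (p : F[X]).coeff m = 0 := h
    have hp := mem_degreeLT.1 p.2
    refine ⟨⟨p, mem_degreeLT.2 ?_⟩, Subtype.ext (A.coe_inclMap_apply χ _)⟩
    rw [degree_lt_iff_coeff_zero] at hp ⊢
    intro i hi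
    obtain rfl | hi := hi.eq_or_lt
    · exact h
    · exact hp i hi
  · rintro ⟨r, rfl⟩
    change (A.inclMap χ m r : F[X]).coeff m = 0
    rw [coe_inclMap_apply]
    exact (degree_lt_iff_coeff_zero _ _).1 (mem_degreeLT.1 r.2) m le_rfl

theorem coeffMap_surjective (χ : Γ →* F) {m : ℕ} (hm) :
    Function.Surjective (A.coeffMap χ m hm) := fun a =>
  ⟨⟨monomial m a, mem_degreeLT.2 ((degree_monomial_le _ _).trans_lt
    (by exact_mod_cast m.lt_succ_self))⟩, coeff_monomial_same m a⟩

variable {q : ℕ} [Fact q.Prime] (B : AffineData Γ (ZMod q)) (χ : Γ →* ZMod q)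

/-- The polynomial `1 - X ^ (q - 1)`, which is the indicator function of `0`. -/
noncomputable def deltaZero (q : ℕ) [Fact q.Prime] : degreeLT (ZMod q) q :=
  ⟨1 - X ^ (q - 1), by
    have := (Fact.out : q.Prime).pos
    rw [mem_degreeLT]
    refine (degree_sub_le _ _).trans_lt (max_lt ?_ ?_)
    · rw [degree_one]; exact_mod_cast this
    · rw [degree_X_pow]; exact_mod_cast (by lia)⟩

theorem eval_deltaZero (x : ZMod q) :
    (deltaZero q : (ZMod q)[X]).eval x = if x = 0 then 1 else 0 := by
  have := (Fact.out : q.Prime).two_le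
  split_ifs with h
  · simp [deltaZero, h, show q - 1 ≠ 0 by lia]
  · simp [deltaZero, ZMod.pow_card_sub_one_eq_one h]

theorem eq_of_eval_eq {p r : degreeLT (ZMod q) q}
    (h : ∀ x, (p : (ZMod q)[X]).eval x = (r : (ZMod q)[X]).eval x) : p = r := by
  refine Subtype.ext (eq_of_degrees_lt_of_eval_finset_eq Finset.univ ?_ ?_ fun x _ => h x)
  · simpa [ZMod.card] using mem_degreeLT.1 p.2
  · simpa [ZMod.card] using mem_degreeLT.1 r.2

theorem sum_conj_eq_id [Fintype Γ] {N : ZMod q} (hN : N ≠ 0)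
    (hB : ∀ y, ∑ g, (if B.shift g = y then 1 else 0) = N) (p : degreeLT (ZMod q) q) :
    ∑ g : Γ, B.polyRep χ q g⁻¹ (((leval 0 ∘ₗ Submodule.subtype _).smulRight (N⁻¹ • deltaZero q))
      (B.polyRep χ q g p)) = p := by
  refine eq_of_eval_eq fun y => ?_
  have key (g : Γ) : ((B.polyRep χ q g⁻¹ (((leval 0 ∘ₗ Submodule.subtype _).smulRight
      (N⁻¹ • deltaZero q)) (B.polyRep χ q g p)) : degreeLT (ZMod q) q) : (ZMod q)[X]).eval y =
      N⁻¹ * (p : (ZMod q)[X]).eval y * if B.shift g = y then 1 else 0 := by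
    have h1 : χ g⁻¹ * χ g = 1 := by rw [← map_mul, inv_mul_cancel, map_one]
    have h2 : B.scale g⁻¹ * B.scale g = 1 := by rw [← map_mul, inv_mul_cancel, map_one]
    have h3 : B.scale g⁻¹ * y + B.shift g⁻¹ = 0 ↔ B.shift g = y := by
      rw [← neg_neg (B.shift g⁻¹), ← B.scale_inv_mul_shift, ← sub_eq_add_neg, ← mul_sub,
        mul_eq_zero, or_iff_right (left_ne_zero_of_mul_eq_one h2), sub_eq_zero, eq_comm]
    simp only [polyRep_apply_coe, LinearMap.smulRight_apply, LinearMap.comp_apply,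
      Submodule.subtype_apply, leval_apply, eval_smul, eval_comp_poly, Submodule.coe_smul,
      eval_deltaZero, h3, smul_eq_mul, mul_zero, zero_add, smul_comp]
    split_ifs with h
    · rw [h]
      linear_combination N⁻¹ * eval y (p : (ZMod q)[X]) * h1
    · simp
  rw [AddSubmonoidClass.coe_finsetSum, eval_finsetSum, Finset.sum_congr rfl fun g _ => key g,
    ← Finset.mul_sum, hB, mul_right_comm, inv_mul_cancel₀ hN, one_mul]

theorem natCast_succ_ne_zero {i : ℕ} (hi : i + 1 < q) : (i + 1 : ZMod q) ≠ 0 := by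
  intro h
  exact Nat.not_dvd_of_pos_of_lt i.succ_pos hi
    ((ZMod.natCast_eq_zero_iff _ _).1 (by simpa using h))

theorem derivMap_surjective {m : ℕ} (hm : m < q) : Function.Surjective (B.derivMap χ m) := by
  intro r
  refine ⟨⟨∑ i ∈ Finset.range m, monomial (i + 1) ((r : (ZMod q)[X]).coeff i / (i + 1)), ?_⟩,
    Subtype.ext ?_⟩
  · refine Submodule.sum_mem _ fun i hi => mem_degreeLT.2 ((degree_monomial_le _ _).trans_lt ?_)
    have := Finset.mem_range.1 hi
    exact_mod_cast (by lia)
  · have hr : (r : (ZMod q)[X]).natDegree < m ∨ (r : (ZMod q)[X]) = 0 := by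
      by_cases h0 : (r : (ZMod q)[X]) = 0
      · exact .inr h0
      · exact .inl ((natDegree_lt_iff_degree_lt h0).2 (mem_degreeLT.1 r.2))
    change derivative _ = (r : (ZMod q)[X])
    have h : ∀ i ∈ Finset.range m, derivative (monomial (i + 1)
        ((r : (ZMod q)[X]).coeff i / (i + 1))) = monomial i ((r : (ZMod q)[X]).coeff i) := by
      intro i hi
      have := natCast_succ_ne_zero (q := q) (show i + 1 < q by grind)
      rw [derivative_monomial, Nat.add_sub_cancel, Nat.cast_add_one, div_mul_cancel₀ _ this]
    rw [Submodule.subtype_apply, derivative_sum, Finset.sum_congr rfl h]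
    obtain hr | hr := hr
    · exact (as_sum_range' _ _ hr).symm
    · simp [hr]

theorem derivMap_eq_zero_iff {m : ℕ} (hm : m < q) (p : degreeLT (ZMod q) (m + 1)) :
    B.derivMap χ m p = 0 ↔ ∃ a, B.constMap χ m.succ_pos a = p := by
  constructor
  · intro h
    replace h : derivative (p : (ZMod q)[X]) = 0 := congrArg Subtype.val h
    refine ⟨(p : (ZMod q)[X]).coeff 0, Subtype.ext ?_⟩
    change C _ = (p : (ZMod q)[X])
    ext i
    obtain _ | i := i
    · simp
    rw [coeff_C_succ]
    by_cases hi : i < m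
    · have h1 := congrArg (coeff · i) h
      simp only [coeff_derivative, coeff_zero] at h1
      exact ((mul_eq_zero.1 h1).resolve_right (natCast_succ_ne_zero (by lia))).symm
    · have := mem_degreeLT.1 p.2
      rw [degree_lt_iff_coeff_zero] at this
      exact (this _ (by lia)).symm
  · rintro ⟨a, rfl⟩
    exact Subtype.ext derivative_C

end AffineData

namespace AffineData
variable {Γ : Type} [Group Γ] {q : ℕ} [Fact q.Prime] (B : AffineData Γ (ZMod q)) (χ : Γ →* ZMod q)

/-- The maps `x ↦ scale g * x + shift g` include every translation, and every value of `shift` is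
attained `N` times, where `N` is invertible in `ZMod q`. -/
structure IsUniform [Fintype Γ] (N : ZMod q) : Prop where
  ne_zero : N ≠ 0
  sum_fiber : ∀ y, ∑ g, (if B.shift g = y then 1 else 0) = N
  exists_translation : ∀ y, ∃ g, B.shift g = y ∧ B.scale g = 1

variable {B} [Fintype Γ] {N : ZMod q}

theorem IsUniform.isZero_groupCohomology (hB : B.IsUniform N) {m : ℕ} (hm : m = q) (n : ℕ) :
    IsZero (groupCohomology (Rep.of (B.polyRep χ m)) (n + 1)) := by
  subst hm
  exact groupCohomology.isZero_of_sum_conj_eq_id (Rep.of (B.polyRep χ m)) _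
    (B.sum_conj_eq_id χ hB.ne_zero hB.sum_fiber) n

theorem IsUniform.coeffMap_eq_zero_of_mem_invariants (hB : B.IsUniform N) {m : ℕ} (hm : m + 1 = q)
    (hχ : ∀ g, B.scale g = 1 → χ g = 1) (hc) {p : degreeLT (ZMod q) (m + 1)}
    (hp : p ∈ (B.polyRep χ (m + 1)).invariants) :
    B.coeffMap χ m hc p = 0 := by
  subst hm
  have hm0 : m ≠ 0 := by
    have := (Fact.out : (m + 1).Prime).two_le
    lia
  have hconst : p = B.constMap χ m.succ_pos ((p : (ZMod (m + 1))[X]).eval 0) := by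
    refine eq_of_eval_eq fun y => ?_
    change _ = eval y (C _)
    obtain ⟨g, rfl, hg⟩ := hB.exists_translation y
    have h := congrArg (fun r : degreeLT (ZMod (m + 1)) (m + 1) => (r : (ZMod (m + 1))[X]).eval 0)
      (hp g)
    simpa [polyRep_apply_coe, poly, hg, hχ g hg] using h
  rw [hconst]
  change (C _).coeff m = 0
  rw [coeff_C, if_neg hm0]

/-- Dimension shifting along the exact sequences `0 → F → F[X]_{<q} → F[X]_{<q-1} → 0` and
`0 → F[X]_{<q-1} → F[X]_{<q} → F → 0` given by the derivative and the top coefficient. -/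
theorem IsUniform.nonempty_iso_add_two (hB : B.IsUniform N) (hs : ∀ g, B.scale g ^ (q - 1) = 1)
    (i n : ℕ) :
    Nonempty (groupCohomology (Rep.of (charRep (B.scale ^ (i + 1)))) n ≅
      groupCohomology (Rep.of (charRep (B.scale ^ i))) (n + 2)) := by
  rw [pow_succ]
  have hq := (Fact.out : q.Prime).pos
  have hm : q - 1 + 1 = q := Nat.sub_add_cancel hq
  obtain ⟨w₁, h₁⟩ := Rep.exists_shortExact_mk
    (Rep.ofHom (B.constMap (B.scale ^ i) (q - 1).succ_pos))
    (Rep.ofHom (B.derivMap (B.scale ^ i) (q - 1)))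
    (fun a b h => C_injective (congrArg Subtype.val h))
    (B.derivMap_surjective _ (by lia)) (B.derivMap_eq_zero_iff _ (by lia))
  obtain ⟨w₂, h₂⟩ := Rep.exists_shortExact_mk
    (Rep.ofHom (B.inclMap (B.scale ^ i * B.scale) (q - 1)))
    (Rep.ofHom (B.coeffMap (B.scale ^ i * B.scale) (q - 1) hs))
    (fun a b h => Subtype.ext (by
      have := congrArg Subtype.val h
      change (B.inclMap _ _ a : (ZMod q)[X]) = B.inclMap _ _ b at this
      rwa [coe_inclMap_apply, coe_inclMap_apply] at this))
    (B.coeffMap_surjective _ hs) (B.coeffMap_eq_zero_iff _ hs)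
  obtain ⟨e₁⟩ := groupCohomology.nonempty_iso_succ_of_isZero h₁ (n + 1)
    (hB.isZero_groupCohomology _ hm _) ((hB.isZero_groupCohomology _ hm _).eq_zero_of_src _)
  obtain ⟨e₂⟩ := groupCohomology.nonempty_iso_succ_of_isZero h₂ n
    (hB.isZero_groupCohomology _ hm _) (by
      obtain _ | n := n
      · exact groupCohomology.map_zero_eq_zero _ fun v hv =>
          hB.coeffMap_eq_zero_of_mem_invariants _ hm (fun g hg => by simp [hg]) hs hv
      · exact (hB.isZero_groupCohomology _ hm _).eq_zero_of_src _)
  exact ⟨e₂ ≪≫ e₁⟩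

theorem IsUniform.nonempty_iso_two_mul (hB : B.IsUniform N) (hs : ∀ g, B.scale g ^ (q - 1) = 1)
    (j i : ℕ) :
    Nonempty (groupCohomology (Rep.of (charRep (B.scale ^ (i + j)))) 0 ≅
      groupCohomology (Rep.of (charRep (B.scale ^ i))) (2 * j)) := by
  induction j generalizing i with
  | zero => exact ⟨Iso.refl _⟩
  | succ j ih =>
    obtain ⟨e₁⟩ := ih (i + 1)
    obtain ⟨e₂⟩ := hB.nonempty_iso_add_two hs i (2 * j)
    rw [show i + (j + 1) = i + 1 + j by lia]
    exact ⟨e₁ ≪≫ e₂⟩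

theorem IsUniform.nonempty_addEquiv_invariants (hB : B.IsUniform N)
    (hs : ∀ g, B.scale g ^ (q - 1) = 1) (j : ℕ) :
    Nonempty (groupCohomology (Rep.trivial (ZMod q) Γ (ZMod q)) (2 * j) ≃+
      (charRep (B.scale ^ j)).invariants) := by
  obtain ⟨e⟩ := hB.nonempty_iso_two_mul hs j 0
  rw [zero_add, pow_zero] at e
  have h : charRep (1 : Γ →* ZMod q) = Representation.trivial (ZMod q) Γ (ZMod q) := by
    ext; simp [charRep]
  rw [h] at e
  exact ⟨(e.symm ≪≫ groupCohomology.H0Iso _).toLinearEquiv.toAddEquiv⟩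

end AffineData

theorem mem_invariants_charRep {Γ F : Type} [Group Γ] [Field F] {χ : Γ →* F} {a : F} :
    a ∈ (charRep χ).invariants ↔ a = 0 ∨ χ = 1 := by
  have (g : Γ) : charRep χ g a = a ↔ a = 0 ∨ χ g = 1 := by
    rw [or_comm, ← mul_left_eq_self₀]
    rfl
  rw [Representation.mem_invariants, forall_congr' this, forall_or_left, MonoidHom.ext_iff]
  rfl

variable {p q : ℕ}

theorem toAdd_mulAut_zmod_apply (f : MulAut (Multiplicative (ZMod q))) (x : ZMod q) :
    (f (ofAdd x)).toAdd = x * (f (ofAdd 1)).toAdd := by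
  have h : ∀ n : ℤ, (f (ofAdd (n : ZMod q))).toAdd = n * (f (ofAdd 1)).toAdd := fun n => by
    rw [← zsmul_one, ofAdd_zsmul, map_zpow, toAdd_zpow, zsmul_eq_mul]
    simp
  simpa using h x.cast

/-- The scalar by which an automorphism of the additive group of `ZMod q` acts. -/
noncomputable def mulAutChar : MulAut (Multiplicative (ZMod q)) →* ZMod q where
  toFun f := (f (ofAdd 1)).toAdd
  map_one' := rfl
  map_mul' f g := by
    rw [MulAut.mul_apply, ← ofAdd_toAdd (g (ofAdd 1)), toAdd_mulAut_zmod_apply, mul_comm, ofAdd_toAdd]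

theorem mulAutChar_injective : Function.Injective (mulAutChar (q := q)) := fun f g h => by
  ext x
  have := toAdd_mulAut_zmod_apply f x.toAdd
  rw [show (f (ofAdd 1)).toAdd = (g (ofAdd 1)).toAdd from h, ← toAdd_mulAut_zmod_apply] at this
  exact this

variable [Fact q.Prime] {G : Type} [CommGroup G] (β : G →* MulAut (Multiplicative (ZMod q)))

/-- The action of `ZMod q ⋊ G` on the affine line over `ZMod q`. -/
noncomputable def semidirectAffineData :
    AffineData (Multiplicative (ZMod q) ⋊[β] G) (ZMod q) where
  scale := ((mulAutChar.comp β).comp invMonoidHom).comp SemidirectProduct.rightHom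
  shift g := -(mulAutChar (β g.right⁻¹) * g.left.toAdd)
  shift_mul g h := by
    have h1 := toAdd_mulAut_zmod_apply (β g.right) h.left.toAdd
    have h2 : mulAutChar (β g.right⁻¹) * mulAutChar (β g.right) = 1 := by
      rw [← map_mul, ← map_mul, inv_mul_cancel, map_one, map_one]
    rw [ofAdd_toAdd] at h1
    change _ = _ * mulAutChar (β g.right) at h1
    simp only [SemidirectProduct.mul_left, SemidirectProduct.mul_right, mul_inv, map_mul, toAdd_mul,
      h1, MonoidHom.comp_apply, SemidirectProduct.rightHom_eq_right, invMonoidHom_apply]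
    linear_combination (-mulAutChar (β h.right⁻¹) * h.left.toAdd) * h2

theorem isUniform_semidirectAffineData [Fintype G] [Fintype (Multiplicative (ZMod q) ⋊[β] G)]
    (h : (Fintype.card G : ZMod q) ≠ 0) :
    (semidirectAffineData β).IsUniform (Fintype.card G : ZMod q) where
  ne_zero := h
  sum_fiber y := by
    rw [← SemidirectProduct.equivProd.symm.sum_comp, Fintype.sum_prod_type_right]
    have key (g : G) : ∑ a : Multiplicative (ZMod q), (if (semidirectAffineData β).shift
        (SemidirectProduct.equivProd.symm (a, g)) = y then (1 : ZMod q) else 0) = 1 := by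
      have h2 : mulAutChar (β g⁻¹) * mulAutChar (β g) = 1 := by
        rw [← map_mul, ← map_mul, inv_mul_cancel, map_one, map_one]
      have h3 (a : Multiplicative (ZMod q)) : (semidirectAffineData β).shift
          (SemidirectProduct.equivProd.symm (a, g)) = y ↔
            a = ofAdd (-(mulAutChar (β g) * y)) := by
        change -(mulAutChar (β g⁻¹) * a.toAdd) = y ↔ a.toAdd = -(mulAutChar (β g) * y)
        constructor <;> intro h
        · linear_combination (-mulAutChar (β g)) * h - a.toAdd * h2
        · linear_combination (-mulAutChar (β g⁻¹)) * h + y * h2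
      simp [h3]
    simp [key]
  exists_translation y := ⟨SemidirectProduct.inl (ofAdd (-y)), by simp [semidirectAffineData],
    by simp [semidirectAffineData]⟩

theorem semidirectAffineData_scale_pow_eq_one_iff (hp : p.Prime) (hβ : Nat.card β.range = p)
    (j : ℕ) : (semidirectAffineData β).scale ^ j = 1 ↔ p ∣ j := by
  have h1 : (semidirectAffineData β).scale ^ j = 1 ↔ ∀ f : β.range, f ^ j = 1 := by
    constructor
    · rintro h ⟨_, g, rfl⟩
      have := DFunLike.congr_fun h (SemidirectProduct.inr g⁻¹)
      refine Subtype.ext (mulAutChar_injective ?_)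
      simpa [semidirectAffineData] using this
    · intro h
      ext g
      have := congrArg (mulAutChar ∘ Subtype.val) (h ⟨_, g.right⁻¹, rfl⟩)
      simpa [semidirectAffineData] using this
  rw [h1, ← hβ]
  have := Fact.mk hp
  have hcyc := isCyclic_of_prime_card hβ
  rw [← IsCyclic.exponent_eq_card, Monoid.exponent_dvd_iff_forall_pow_eq_one]

end Auxiliary

/-- Let `p` and `q` be distinct odd primes, let `k ≥ 1`, and let
`β : ZMod (p^k) → Aut(ZMod q)` be a group homomorphism whose image has order exactly `p`. Let `Γ`
be the semidirect product `(ZMod q) ⋊ (ZMod (p^k))` with respect to `β`. Then for every positive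
integer `j`, the group cohomology `H^{2j}(Γ, F_q)` with trivial coefficients in `F_q = ZMod q`
vanishes if `p` does not divide `j`, and is nonzero (isomorphic to `F_q`) if `p` divides `j`. -/
theorem cohomology_of_metacyclic_group_two_p_periodic
    (p q : ℕ) (hp : p.Prime) (hq : q.Prime) (hpodd : Odd p) (hqodd : Odd q) (hpq : p ≠ q)
    (k : ℕ) (hk : 1 ≤ k)
    (β : Multiplicative (ZMod (p ^ k)) →* MulAut (Multiplicative (ZMod q)))
    (hβ : Nat.card β.range = p) :
    ∀ j : ℕ, 0 < j →
      (¬ p ∣ j →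
        Subsingleton
          (groupCohomology
            (Rep.trivial (ZMod q)
              (Multiplicative (ZMod q) ⋊[β] Multiplicative (ZMod (p ^ k))) (ZMod q)) (2 * j))) ∧
      (p ∣ j →
        Nonempty
          ((groupCohomology
            (Rep.trivial (ZMod q)
              (Multiplicative (ZMod q) ⋊[β] Multiplicative (ZMod (p ^ k))) (ZMod q)) (2 * j)) ≃+
           ZMod q)) := by
  have : Fact q.Prime := ⟨hq⟩
  have : NeZero (p ^ k) := ⟨pow_ne_zero _ hp.ne_zero⟩
  have hcard : (Fintype.card (Multiplicative (ZMod (p ^ k))) : ZMod q) ≠ 0 := by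
    rw [Fintype.card_multiplicative, ZMod.card, Ne, ZMod.natCast_eq_zero_iff]
    exact fun h => hpq ((Nat.prime_dvd_prime_iff_eq hq hp).1 (hq.dvd_of_dvd_pow h)).symm
  have := Fintype.ofEquiv _ (SemidirectProduct.equivProd (φ := β)).symm
  have hB := isUniform_semidirectAffineData β hcard
  have hs (g) : (semidirectAffineData β).scale g ^ (q - 1) = 1 :=
    ZMod.pow_card_sub_one_eq_one
      (((Group.isUnit g).map (semidirectAffineData β).scale).ne_zero)
  intro j _
  obtain ⟨e⟩ := hB.nonempty_addEquiv_invariants hs j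
  have hj := semidirectAffineData_scale_pow_eq_one_iff β hp hβ j
  refine ⟨fun h => ?_, fun h => ?_⟩
  · have hz : Subsingleton (charRep ((semidirectAffineData β).scale ^ j)).invariants := by
      refine ⟨fun a b => Subtype.ext ?_⟩
      rw [(mem_invariants_charRep.1 a.2).resolve_right (mt hj.1 h),
        (mem_invariants_charRep.1 b.2).resolve_right (mt hj.1 h)]
    exact e.toEquiv.subsingleton
  · have htop : (charRep ((semidirectAffineData β).scale ^ j)).invariants = ⊤ :=
      eq_top_iff.2 fun a _ => mem_invariants_charRep.2 (.inr (hj.2 h))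
    exact ⟨e.trans ((LinearEquiv.ofTop _ htop).toAddEquiv)⟩
end
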